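/- For every positive integer n, the set WD_{2n} of weighted Dyck paths of length 2n and the set A_{2n}(1234) of up-down permutations of size 2n avoiding 1234 have the same cardinality. -/

import Mathlib

/-- The `i`-th letter (1-based) of the word `w`. -/
def letter (w : List ℕ) (i : ℕ) : ℕ := w.getD (i - 1) 0

/-- `w` is a permutation word of size `N`, i.e. a rearrangement of `1, …, N`. -/
def IsPermWord (N : ℕ) (w : List ℕ) : Prop :=
  w.length = N ∧ ∀ k, k ∈ w ↔ k ∈ Finset.Icc 1 N

/-- `w` (of size `2n`) is up-down: `σ_{2i-1} < σ_{2i}` for `1 ≤ i ≤ n`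
and `σ_{2i} > σ_{2i+1}` for `1 ≤ i ≤ n-1`. -/
def IsUpDown (n : ℕ) (w : List ℕ) : Prop :=
  (∀ i, 1 ≤ i → i ≤ n → letter w (2 * i - 1) < letter w (2 * i)) ∧
  (∀ i, 1 ≤ i → i ≤ n - 1 → letter w (2 * i + 1) < letter w (2 * i))

/-- `w` avoids the pattern `1234`: no positions `p < q < r < s` with increasing letters. -/
def Avoids1234 (w : List ℕ) : Prop :=
  ¬∃ p q r s, 1 ≤ p ∧ p < q ∧ q < r ∧ r < s ∧ s ≤ w.length ∧
    letter w p < letter w q ∧ letter w q < letter w r ∧ letter w r < letter w s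

/-- Membership in `A_{2n}(1234)`: an up-down permutation word of size `2n` avoiding `1234`. -/
def IsA (n : ℕ) (w : List ℕ) : Prop :=
  IsPermWord (2 * n) w ∧ IsUpDown n w ∧ Avoids1234 w

/-- A weighted lattice path: a list of steps (`true` = up-step `(1,1)`,
`false` = down-step `(1,-1)`) together with a list of weights, one per step. -/
structure WDP where
  steps : List Bool
  weights : List ℕ

/-- Height of the path after the first `k` steps. -/
def ht (s : List Bool) (k : ℕ) : ℕ :=
  (s.take k).count true - (s.take k).count false

/-- `s` is a Dyck path: every prefix has at least as many up-steps as
down-steps, and the total numbers of up-steps and down-steps agree. -/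
def IsDyck (s : List Bool) : Prop :=
  (∀ k, (s.take k).count false ≤ (s.take k).count true) ∧
    s.count false = s.count true

/-- `p` is a weighted Dyck path in `WD_{2n}`. -/
def IsWD (n : ℕ) (p : WDP) : Prop :=
  p.steps.length = 2 * n ∧ p.weights.length = 2 * n ∧ IsDyck p.steps ∧
  -- (1) each weight is at most the lower height of its step
  (∀ i < 2 * n,
    p.weights.getD i 0 ≤ min (ht p.steps i) (ht p.steps (i + 1))) ∧
  -- (2) weights are non-decreasing along consecutive up-steps
  (∀ i, i + 1 < 2 * n → p.steps.getD i false = true → p.steps.getD (i + 1) false = true →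
    p.weights.getD i 0 ≤ p.weights.getD (i + 1) 0) ∧
  -- (3) weights are non-increasing along consecutive down-steps
  (∀ i, i + 1 < 2 * n → p.steps.getD i false = false → p.steps.getD (i + 1) false = false →
    p.weights.getD (i + 1) 0 ≤ p.weights.getD i 0) ∧
  -- (4) peak condition: e + d ≤ h
  (∀ i, i + 1 < 2 * n → p.steps.getD i false = true → p.steps.getD (i + 1) false = false →
    p.weights.getD i 0 + p.weights.getD (i + 1) 0 ≤ ht p.steps (i + 1)) ∧
  -- (5) valley condition: d + e ≥ h
  (∀ i, i + 1 < 2 * n → p.steps.getD i false = false → p.steps.getD (i + 1) false = true →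
    ht p.steps (i + 1) ≤ p.weights.getD i 0 + p.weights.getD (i + 1) 0)

/-- Reflection (Schützenberger involution) of a weighted Dyck path: read the
path from right to left, exchanging up-steps and down-steps, keeping the
weight of each step. -/
def reflectWD (p : WDP) : WDP :=
  ⟨(p.steps.map (fun b => !b)).reverse, p.weights.reverse⟩

/-- The word read off a list of (bottom, top) pairs. -/
def flat (c : List (ℕ × ℕ)) : List ℕ := c.flatMap fun x => [x.1, x.2]

@[simp] theorem flat_nil : flat [] = [] := rfl

@[simp] theorem flat_cons (x : ℕ × ℕ) (c : List (ℕ × ℕ)) :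
    flat (x :: c) = x.1 :: x.2 :: flat c := rfl

@[simp] theorem flat_append (c d : List (ℕ × ℕ)) : flat (c ++ d) = flat c ++ flat d := by
  simp [flat]

theorem mem_flat {c : List (ℕ × ℕ)} {v : ℕ} : v ∈ flat c ↔ ∃ x ∈ c, v = x.1 ∨ v = x.2 := by
  simp [flat]

theorem flat_sublist {c d : List (ℕ × ℕ)} (h : c.Sublist d) : (flat c).Sublist (flat d) := by
  induction h with
  | slnil => simp
  | cons a _ ih => exact (ih.cons _).cons _
  | cons_cons a _ ih => exact (ih.cons_cons _).cons_cons _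

/-- No strictly increasing subsequence of length four. -/
def NoInc4 (w : List ℕ) : Prop := ∀ s : List ℕ, s.Sublist w → s.Pairwise (· < ·) → s.length ≤ 3

/-- A partial up-down permutation on the values `1, …, k`, as a list of (bottom, top) pairs; a top
equal to `M` stands for a value yet to be chosen. -/
structure Conf (M k : ℕ) (c : List (ℕ × ℕ)) : Prop where
  bot : ∀ x ∈ c, 1 ≤ x.1 ∧ x.1 ≤ k
  top : ∀ x ∈ c, x.1 < x.2 ∧ (x.2 ≤ k ∨ x.2 = M)
  down : c.IsChain fun x y => y.1 < x.2
  count : ∀ v, 1 ≤ v → v ≤ k → (flat c).count v = 1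
  avoid : NoInc4 (flat c)

/-- Erase the values larger than `k`. -/
def restrict (M k : ℕ) (c : List (ℕ × ℕ)) : List (ℕ × ℕ) :=
  (c.filter fun x => decide (x.1 ≤ k)).map fun x => (x.1, if x.2 ≤ k then x.2 else M)

theorem restrict_append (M k : ℕ) (c d : List (ℕ × ℕ)) :
    restrict M k (c ++ d) = restrict M k c ++ restrict M k d := by
  simp [restrict]

theorem restrict_cons (M k : ℕ) (x : ℕ × ℕ) (c : List (ℕ × ℕ)) :
    restrict M k (x :: c) =
      (if x.1 ≤ k then [(x.1, if x.2 ≤ k then x.2 else M)] else []) ++ restrict M k c := by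
  by_cases h : x.1 ≤ k <;> simp [restrict, h]

theorem restrict_eq_self {M k : ℕ} {c : List (ℕ × ℕ)}
    (h : ∀ x ∈ c, x.1 ≤ k ∧ (x.2 ≤ k ∨ x.2 = M)) : restrict M k c = c := by
  induction c with
  | nil => rfl
  | cons x c ih =>
    rw [restrict_cons, ih fun y hy => h y (List.mem_cons_of_mem _ hy)]
    obtain ⟨h1, h2⟩ := h x List.mem_cons_self
    obtain ⟨b, t⟩ := x
    simp only at h1 h2
    by_cases ht : t ≤ k
    · simp [h1, ht]
    · simp [h1, h2.resolve_left ht]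

theorem restrict_restrict {M j k : ℕ} (hjk : j ≤ k) (hM : j < M) (c : List (ℕ × ℕ)) :
    restrict M j (restrict M k c) = restrict M j c := by
  induction c with
  | nil => rfl
  | cons x c ih =>
    rw [restrict_cons, restrict_append, ih, restrict_cons M j]
    obtain ⟨b, t⟩ := x
    congr 1
    by_cases h1 : b ≤ k
    · by_cases h2 : t ≤ k
      · simp only [restrict, h1, h2, if_true, List.filter_cons, List.filter_nil]
        by_cases h3 : b ≤ j
        · by_cases h4 : t ≤ j <;> simp [h3, h4]
        · simp [h3]
      · have : ¬ t ≤ j := by omega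
        have : ¬ M ≤ j := by omega
        simp [restrict, List.filter_cons, *]
        by_cases h3 : b ≤ j <;> simp [h3]
    · have : ¬ b ≤ j := by omega
      simp [restrict, h1, this]

/-- The length of the longest prefix with all tops equal to `M` and weakly decreasing bottoms,
all of them at most `m`. -/
def run (M : ℕ) : ℕ → List (ℕ × ℕ) → ℕ
  | _, [] => 0
  | m, x :: c => if x.2 = M ∧ x.1 ≤ m then run M x.1 c + 1 else 0

/-- `l` has only open tops and weakly decreasing bottoms, and this fails for `l` followed by the
first pair of `r`. -/
structure IsRun (M : ℕ) (l r : List (ℕ × ℕ)) : Prop where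
  top : ∀ x ∈ l, x.2 = M
  dec : l.Pairwise fun x y => y.1 ≤ x.1
  maximal : ∀ x ∈ r.head?, x.2 ≠ M ∨ ∃ y ∈ l, y.1 < x.1

theorem run_append {M m : ℕ} {l r : List (ℕ × ℕ)} (h1 : ∀ x ∈ l, x.2 = M ∧ x.1 ≤ m)
    (h2 : l.Pairwise fun x y => y.1 ≤ x.1)
    (h3 : ∀ x ∈ r.head?, x.2 ≠ M ∨ m < x.1 ∨ ∃ y ∈ l, y.1 < x.1) :
    run M m (l ++ r) = l.length := by
  induction l generalizing m with
  | nil =>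
    cases r with
    | nil => rfl
    | cons x r =>
      have := h3 x rfl
      simp only [List.nil_append, run, List.length_nil]
      simp at this
      rw [if_neg]; omega
  | cons x l ih =>
    have hx := h1 x List.mem_cons_self
    rw [List.pairwise_cons] at h2
    simp only [List.cons_append, run, if_pos hx, List.length_cons, Nat.add_right_cancel_iff]
    refine ih (fun y hy => ⟨(h1 y (List.mem_cons_of_mem _ hy)).1, h2.1 y hy⟩) h2.2 ?_
    intro z hz
    rcases h3 z hz with h | h | ⟨y, hy, h⟩
    · exact .inl h
    · exact .inr (.inl (by omega))
    · rcases List.mem_cons.1 hy with rfl | hy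
      · exact .inr (.inl h)
      · exact .inr (.inr ⟨y, hy, h⟩)

theorem exists_run (M m : ℕ) (c : List (ℕ × ℕ)) :
    ∃ l r, c = l ++ r ∧ l.length = run M m c ∧ (∀ x ∈ l, x.2 = M ∧ x.1 ≤ m) ∧
      (l.Pairwise fun x y => y.1 ≤ x.1) ∧
      ∀ x ∈ r.head?, x.2 ≠ M ∨ m < x.1 ∨ ∃ y ∈ l, y.1 < x.1 := by
  induction c generalizing m with
  | nil => exact ⟨[], [], by simp [run]⟩
  | cons x c ih =>
    by_cases hx : x.2 = M ∧ x.1 ≤ m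
    · obtain ⟨l, r, rfl, h2, h3, h4, h5⟩ := ih x.1
      refine ⟨x :: l, r, rfl, ?_, ?_, ?_, ?_⟩
      · simp [run, hx, h2]
      · rintro y hy
        rcases List.mem_cons.1 hy with rfl | hy
        · exact hx
        · exact ⟨(h3 y hy).1, (h3 y hy).2.trans hx.2⟩
      · exact List.pairwise_cons.2 ⟨fun y hy => (h3 y hy).2, h4⟩
      · intro z hz
        rcases h5 z hz with h | h | ⟨y, hy, h⟩
        · exact .inl h
        · exact .inr (.inr ⟨x, List.mem_cons_self, h⟩)
        · exact .inr (.inr ⟨y, List.mem_cons_of_mem _ hy, h⟩)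
    · refine ⟨[], x :: c, rfl, ?_, by simp, by simp, ?_⟩
      · simp only [run, if_neg hx, List.length_nil]
      · intro z hz
        simp at hz
        subst hz
        by_contra hcon
        push Not at hcon
        exact hx ⟨hcon.1, hcon.2.1⟩

/-- The number of open tops, and the length of the initial run. -/
def st (M : ℕ) (c : List (ℕ × ℕ)) : ℕ × ℕ :=
  (c.countP fun x => decide (x.2 = M), run M M c)

theorem IsRun.run_eq {M : ℕ} {l r : List (ℕ × ℕ)} (h : IsRun M l r)
    (hb : ∀ x ∈ l ++ r, x.1 ≤ M) : run M M (l ++ r) = l.length := by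
  refine run_append (fun x hx => ⟨h.top x hx, hb x (by simp [hx])⟩) h.dec fun x hx => ?_
  exact (h.maximal x hx).imp_right .inr

theorem exists_isRun {M : ℕ} {c : List (ℕ × ℕ)} (hb : ∀ x ∈ c, x.1 ≤ M) :
    ∃ l r, c = l ++ r ∧ l.length = run M M c ∧ IsRun M l r := by
  obtain ⟨l, r, rfl, h2, h3, h4, h5⟩ := exists_run M M c
  refine ⟨l, r, rfl, h2, fun x hx => (h3 x hx).1, h4, fun x hx => ?_⟩
  have := hb x (by simp [List.mem_of_mem_head? hx])
  rcases h5 x hx with h | h | h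
  · exact .inl h
  · omega
  · exact .inr h

/-- The allowed moves of (height, parameter). -/
def Move (s t : ℕ × ℕ) : Prop :=
  (t.1 = s.1 + 1 ∧ 1 ≤ t.2 ∧ t.2 ≤ s.2 + 1) ∨ (s.1 = t.1 + 1 ∧ t.2 ≤ s.2 ∧ t.2 ≤ t.1)

/-- `c'` arises from `c` by inserting the value `v` as a bottom or as a top. -/
inductive Child (M v : ℕ) (c c' : List (ℕ × ℕ)) : Prop
  | bot (p q : List (ℕ × ℕ)) (hc : c = p ++ q) (hc' : c' = p ++ (v, M) :: q)
      (hp : p.length ≤ run M M c)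
  | top (p q : List (ℕ × ℕ)) (b : ℕ) (hc : c = p ++ (b, M) :: q) (hc' : c' = p ++ (b, v) :: q)
      (hp : p.length < run M M c ∨ ∀ x ∈ q, x.2 ≠ M)

/-- At most one value increases strictly along the bottoms of a run. -/
theorem length_le_one_of_run {M : ℕ} {l : List (ℕ × ℕ)} (ht : ∀ x ∈ l, x.2 = M)
    (hd : l.Pairwise fun x y => y.1 ≤ x.1) {s : List ℕ}
    (hs : s.Sublist (flat l)) (hM : ∀ x ∈ s, x < M) (hi : s.Pairwise (· < ·)) : s.length ≤ 1 := by
  have hd : (l.map Prod.fst).Pairwise (· ≥ ·) := by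
    rw [List.pairwise_map]; exact hd
  have hs' : s.Sublist (l.map Prod.fst) := by
    have h1 := hs.filter (fun x => decide (x < M))
    rw [List.filter_eq_self.2 (by simpa using hM)] at h1
    refine h1.trans ?_
    clear hs hM hi h1 hd
    induction l with
    | nil => simp
    | cons x l ih =>
      have hx : x.2 = M := ht x List.mem_cons_self
      have := ih (fun y hy => ht y (List.mem_cons_of_mem _ hy)) (by grind)
      by_cases hxM : x.1 < M
      · simpa [List.filter_cons, hx, hxM] using this
      · simpa [List.filter_cons, hx, hxM] using this.cons _
  have hd' := hd.sublist hs'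
  match s, hi, hd' with
  | [], _, _ => simp
  | [_], _, _ => simp
  | a :: b :: s, hi, hd' =>
    simp at hi hd'
    omega

theorem length_le_one_of_const {a : ℕ} {s : List ℕ} (h : ∀ x ∈ s, x = a)
    (hi : s.Pairwise (· < ·)) : s.length ≤ 1 := by
  match s, hi with
  | [], _ => simp
  | [_], _ => simp
  | x :: y :: s, hi =>
    simp at hi h
    omega

theorem Conf.mem_flat_le {M k : ℕ} {c : List (ℕ × ℕ)} (h : Conf M k c) {v : ℕ} (hv : v ∈ flat c) :
    v ≤ k ∨ v = M := by
  obtain ⟨x, hx, rfl | rfl⟩ := mem_flat.1 hv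
  · exact .inl (h.bot x hx).2
  · exact (h.top x hx).2

theorem Conf.count_eq_zero {M k v : ℕ} {c : List (ℕ × ℕ)} (h : Conf M k c) (hk : k < v)
    (hv : v ≠ M) : (flat c).count v = 0 := by
  rw [List.count_eq_zero]
  intro hm
  rcases h.mem_flat_le hm with h | h <;> omega

theorem Conf.exists_isRun_append {M k : ℕ} (hk : k < M) {p q : List (ℕ × ℕ)}
    (h : Conf M k (p ++ q)) (hp : p.length ≤ run M M (p ++ q)) :
    ∃ l r, q = l ++ r ∧ (p ++ l).length = run M M (p ++ q) ∧ IsRun M (p ++ l) r := by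
  obtain ⟨l, r, h1, h2, h3⟩ := exists_isRun (M := M) (c := p ++ q)
    fun x hx => (h.bot x hx).2.trans hk.le
  rw [← h2] at hp ⊢
  rw [List.append_eq_append_iff] at h1
  rcases h1 with ⟨a, rfl, rfl⟩ | ⟨a, rfl, rfl⟩
  · exact ⟨a, r, rfl, rfl, h3⟩
  · obtain rfl : a = [] := by
      simp at hp
      exact hp
    exact ⟨[], q, by simp, by simp, by simpa using h3⟩

theorem Child.restrict_eq {M k : ℕ} {c c' : List (ℕ × ℕ)} (h : Conf M k c)
    (hc : Child M (k + 1) c c') : restrict M k c' = c := by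
  have key : ∀ d : List (ℕ × ℕ), (∀ x ∈ d, x ∈ c) → restrict M k d = d := fun d hd =>
    restrict_eq_self fun x hx => ⟨(h.bot x (hd x hx)).2, (h.top x (hd x hx)).2⟩
  obtain ⟨p, q, h1, rfl, hp⟩ | ⟨p, q, b, h1, rfl, hp⟩ := hc
  · rw [restrict_append, restrict_cons, key p (by simp [h1]; tauto), key q (by simp [h1]; tauto), h1]
    simp
  · have hb := h.bot (b, M) (by simp [h1])
    rw [restrict_append, restrict_cons, key p (by simp [h1]; tauto), key q (by simp [h1]; tauto), h1]
    simp [hb.2]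

theorem Child.conf {M k : ℕ} (hk : k + 1 < M) {c c' : List (ℕ × ℕ)} (h : Conf M k c)
    (hc : Child M (k + 1) c c') : Conf M (k + 1) c' := by
  obtain ⟨p, q, rfl, rfl, hp⟩ | ⟨p, q, b, rfl, rfl, hp⟩ := hc
  · obtain ⟨l, r, rfl, -, hrun⟩ := h.exists_isRun_append (by omega) hp
    have htop : ∀ x ∈ p, x.2 = M := fun x hx => hrun.top x (by simp [hx])
    have hdec := (List.pairwise_append.1 hrun.dec).1
    obtain ⟨q, hq⟩ : ∃ q, q = l ++ r := ⟨_, rfl⟩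
    rw [← hq] at h ⊢
    refine ⟨?_, ?_, ?_, ?_, ?_⟩
    · intro x hx
      have := h.bot x
      grind
    · intro x hx
      have := h.top x
      grind
    · have hd := h.down
      have hb := h.bot
      rw [List.isChain_append] at hd ⊢
      refine ⟨hd.1, ?_, ?_⟩
      · rw [List.isChain_cons]
        refine ⟨fun y hy => ?_, hd.2.1⟩
        have := hb y (by simp [List.mem_of_mem_head? hy])
        simp only
        omega
      · intro x hx y hy
        simp at hy
        have := htop x (List.mem_of_getLast? hx)
        subst hy
        simp only
        omega
    · intro v h1 h2
      have hz := h.count_eq_zero (v := k + 1) (by omega) (by omega)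
      have hv := h.count v h1
      simp only [flat_append, flat_cons, List.count_append, List.count_cons, beq_iff_eq] at hz hv ⊢
      have hMv : M ≠ v := by omega
      by_cases hkv : k + 1 = v
      · subst hkv; simp [hMv]; omega
      · have := hv (by omega)
        simp [hMv, hkv, this]
    · intro s hs hi
      simp only [flat_append, flat_cons] at hs
      obtain ⟨s₁, s₂, rfl, hs₁, hs₂⟩ := List.sublist_append_iff.1 hs
      rw [List.pairwise_append] at hi
      have hone : (∀ x ∈ s₁, x < M) → s₁.length ≤ 1 := fun hx =>
        length_le_one_of_run htop hdec hs₁ hx hi.1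
      rcases List.sublist_cons_iff.1 hs₂ with hs₃ | ⟨s₂, rfl, hs₃⟩
      · rcases List.sublist_cons_iff.1 hs₃ with hs₄ | ⟨s₂, rfl, hs₄⟩
        · refine h.avoid _ ?_ (List.pairwise_append.2 hi)
          rw [flat_append]
          exact hs₁.append hs₄
        · have h1 := hone fun x hx => hi.2.2 x hx M List.mem_cons_self
          obtain rfl : s₂ = [] := by
            rw [List.eq_nil_iff_forall_not_mem]
            intro x hx
            have := (List.pairwise_cons.1 hi.2.1).1 x hx
            have := h.mem_flat_le (v := x) (by simp [hs₄.subset hx])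
            omega
          simp; omega
      · have h1 := hone fun x hx => (hi.2.2 x hx (k + 1) List.mem_cons_self).trans hk
        have h2 := List.pairwise_cons.1 hi.2.1
        have h3 : s₂.length ≤ 1 := by
          refine length_le_one_of_const (a := M) (fun x hx => ?_) h2.2
          have := h2.1 x hx
          have hx' := hs₃.subset hx
          rcases List.mem_cons.1 hx' with hx' | hx'
          · exact hx'
          · have := h.mem_flat_le (v := x) (by simp [hx'])
            omega
        simp; omega
  · have hbk := h.bot (b, M) (by simp)
    refine ⟨?_, ?_, ?_, ?_, ?_⟩
    · intro x hx
      have := h.bot x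
      grind
    · intro x hx
      have := h.top x
      grind
    · have hd := h.down
      have hb := h.bot
      rw [List.isChain_append, List.isChain_cons] at hd ⊢
      refine ⟨hd.1, ⟨fun y hy => ?_, hd.2.1.2⟩, ?_⟩
      · have := hb y (by simp [List.mem_of_mem_head? hy])
        simp only
        omega
      · simpa using hd.2.2
    · intro v h1 h2
      have hz := h.count_eq_zero (v := k + 1) (by omega) (by omega)
      have hv := h.count v h1
      simp only [flat_append, flat_cons, List.count_append, List.count_cons, beq_iff_eq] at hz hv ⊢
      have hMv : M ≠ v := by omega
      by_cases hkv : k + 1 = v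
      · subst hkv
        have : M ≠ k + 1 := by omega
        have : b ≠ k + 1 := by omega
        simp [*] at hz ⊢
        omega
      · have := hv (by omega)
        simp [hMv, hkv] at this ⊢
        omega
    · intro s hs hi
      have hs' : s.Sublist ((flat p ++ [b]) ++ (k + 1) :: flat q) := by simpa using hs
      obtain ⟨s₁, s₂, rfl, hs₁, hs₂⟩ := List.sublist_append_iff.1 hs'
      have hi' := hi
      rw [List.pairwise_append] at hi
      rcases List.sublist_cons_iff.1 hs₂ with hs₃ | ⟨s₂, rfl, hs₃⟩
      · refine h.avoid _ ?_ hi'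
        have := hs₁.append (hs₃.cons M)
        simpa using this
      · have h2 := List.pairwise_cons.1 hi.2.1
        have hlt : ∀ x ∈ s₁, x < k + 1 := fun x hx => hi.2.2 x hx _ List.mem_cons_self
        have hsM : ∀ x ∈ s₂, x = M := fun x hx => by
          have := h2.1 x hx
          have := h.mem_flat_le (v := x) (by simp [hs₃.subset hx])
          omega
        match s₂, hsM, hs₃, h2 with
        | [], _, _, _ =>
          have := h.avoid (s₁ ++ [M]) ?_ ?_
          · simpa using this
          · have := hs₁.append ((List.nil_sublist (flat q)).cons_cons M)
            simpa using this
          · rw [List.pairwise_append]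
            refine ⟨hi.1, by simp, fun x hx y hy => ?_⟩
            have := hlt x hx
            simp at hy
            omega
        | y :: s₂, hsM, hs₃, h2 =>
          have h3 := length_le_one_of_const hsM h2.2
          have hMq : M ∈ flat q := by
            rw [← hsM y List.mem_cons_self]
            exact hs₃.subset List.mem_cons_self
          obtain ⟨x, hx, hxM⟩ := mem_flat.1 hMq
          have hx1 := (h.bot x (by simp [hx])).2
          have hp' : (p ++ [(b, M)]).length ≤ run M M ((p ++ [(b, M)]) ++ q) := by
            have := hp.resolve_right fun hq => hq x hx (by omega)
            simpa using this
          have h' : Conf M k ((p ++ [(b, M)]) ++ q) := by simpa using h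
          obtain ⟨l, r, rfl, -, hrun⟩ := h'.exists_isRun_append (by omega) hp'
          have h4 : s₁.length ≤ 1 := by
            refine length_le_one_of_run (l := p ++ [(b, M)]) (fun x hx => hrun.top x (by simp at hx ⊢; tauto))
              (List.pairwise_append.1 hrun.dec).1 (hs₁.trans ?_) (fun x hx => (hlt x hx).trans hk) hi.1
            simp
          simp only [List.length_append, List.length_cons] at h3 ⊢
          omega

theorem Conf.restrict_child {M k : ℕ} (hk : k + 1 < M) {c' : List (ℕ × ℕ)}
    (h : Conf M (k + 1) c') :
    Conf M k (restrict M k c') ∧ Child M (k + 1) (restrict M k c') c' := by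
  have hmem : k + 1 ∈ flat c' := by
    rw [← List.count_pos_iff, h.count (k + 1) (by omega) le_rfl]
    exact Nat.one_pos
  obtain ⟨x, hx, hx'⟩ := mem_flat.1 hmem
  obtain ⟨p, q, rfl⟩ := List.append_of_mem hx
  obtain ⟨b, t⟩ := x
  have hc1 := h.count (k + 1) (by omega) le_rfl
  have hxt := h.top _ hx
  have hxb := h.bot _ hx
  simp only [flat_append, flat_cons, List.count_append, List.count_cons, beq_iff_eq] at hc1
  simp only at hx' hxt hxb
  have hp0 : k + 1 ∉ flat p := by rw [← List.count_eq_zero]; grind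
  have hq0 : k + 1 ∉ flat q := by rw [← List.count_eq_zero]; grind
  have hside : ∀ y, y ∈ p ∨ y ∈ q → (1 ≤ y.1 ∧ y.1 ≤ k) ∧ y.1 < y.2 ∧ (y.2 ≤ k ∨ y.2 = M) := by
    intro y hy
    have h1 := h.bot y (by simp; tauto)
    have h2 := h.top y (by simp; tauto)
    have h3 : y.1 ≠ k + 1 := by
      rintro he
      rcases hy with hy | hy
      · exact hp0 (mem_flat.2 ⟨y, hy, .inl he.symm⟩)
      · exact hq0 (mem_flat.2 ⟨y, hy, .inl he.symm⟩)
    have h4 : y.2 ≠ k + 1 := by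
      rintro he
      rcases hy with hy | hy
      · exact hp0 (mem_flat.2 ⟨y, hy, .inr he.symm⟩)
      · exact hq0 (mem_flat.2 ⟨y, hy, .inr he.symm⟩)
    omega
  have hp : restrict M k p = p := restrict_eq_self fun y hy => by have := hside y (.inl hy); omega
  have hq : restrict M k q = q := restrict_eq_self fun y hy => by have := hside y (.inr hy); omega
  have hd := h.down
  rw [List.isChain_append, List.isChain_cons] at hd
  rcases hx' with rfl | rfl
  · obtain rfl : t = M := by omega
    rw [restrict_append, restrict_cons, hp, hq]
    simp only [show ¬ k + 1 ≤ k by omega, if_false, List.nil_append]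
    have hcnt : ∀ v, 1 ≤ v → v ≤ k → (flat (p ++ q)).count v = 1 := by
      intro v h1 h2
      have := h.count v h1 (by omega)
      have e1 : k + 1 ≠ v := by omega
      have e2 : t ≠ v := by omega
      simpa [List.count_cons, e1, e2] using this
    have hconf : Conf t k (p ++ q) := by
      refine ⟨fun y hy => (hside y (by simpa using hy)).1,
        fun y hy => (hside y (by simpa using hy)).2, ?_, hcnt, ?_⟩
      · rw [List.isChain_append]
        refine ⟨hd.1, hd.2.1.2, fun y hy z hz => ?_⟩
        have h1 := hd.2.2 y hy (k + 1, t) (by simp)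
        have h2 := hside y (.inl (List.mem_of_getLast? hy))
        have h3 := hside z (.inr (List.mem_of_mem_head? hz))
        simp only at h1
        omega
      · intro s hs hi
        refine h.avoid s (hs.trans (flat_sublist ?_)) hi
        simp
    refine ⟨hconf, .bot p q rfl rfl ?_⟩
    by_contra hlt
    push Not at hlt
    obtain ⟨l, r, h1, h2, h3⟩ := exists_isRun (M := t) (c := p ++ q)
      fun x hx => (hconf.bot x hx).2.trans (by omega)
    rw [← h2] at hlt
    obtain ⟨a, rfl, rfl⟩ : ∃ a, p = l ++ a ∧ r = a ++ q := by
      rw [List.append_eq_append_iff] at h1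
      rcases h1 with ⟨a, rfl, rfl⟩ | ⟨a, h⟩
      · simp at hlt
      · exact ⟨a, h⟩
    match a, hlt, h3 with
    | [], hlt, _ => simp at hlt
    | y :: a, _, h3 =>
      have hy := hside y (by simp)
      rcases h3.maximal y (by simp) with hs | ⟨z, hz, hzy⟩
      · have : [y.1, y.2, k + 1, t].Sublist (flat (l ++ (y :: a) ++ (k + 1, t) :: q)) := by
          simp
        have := h.avoid _ this (by simp; omega)
        simp at this
      · have h5 : [z.1, y.1, k + 1, t].Sublist (flat (l ++ (y :: a) ++ (k + 1, t) :: q)) := by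
          have h6 : [z.1].Sublist (flat l) := by
            rw [List.singleton_sublist]; exact mem_flat.2 ⟨z, hz, .inl rfl⟩
          have h7 : [y.1].Sublist (flat (y :: a)) := by simp
          have h8 : [k + 1, t].Sublist (flat ((k + 1, t) :: q)) := by simp
          simpa using (h6.append h7).append h8
        have := h.avoid _ h5 (by simp; omega)
        simp at this
  · rw [restrict_append, restrict_cons, hp, hq]
    have hbk : b ≤ k := by omega
    simp only [show ¬ k + 1 ≤ k by omega, if_false, hbk, if_true, List.singleton_append]
    have hconf : Conf M k (p ++ (b, M) :: q) := by
      refine ⟨?_, ?_, ?_, ?_, ?_⟩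
      · intro y hy
        rcases List.mem_append.1 hy with hy | hy
        · exact (hside y (.inl hy)).1
        · rcases List.mem_cons.1 hy with rfl | hy
          · simp only; omega
          · exact (hside y (.inr hy)).1
      · intro y hy
        rcases List.mem_append.1 hy with hy | hy
        · exact (hside y (.inl hy)).2
        · rcases List.mem_cons.1 hy with rfl | hy
          · exact ⟨by simp only; omega, .inr rfl⟩
          · exact (hside y (.inr hy)).2
      · rw [List.isChain_append, List.isChain_cons]
        refine ⟨hd.1, ⟨fun z hz => ?_, hd.2.1.2⟩, ?_⟩
        · have h3 := hside z (.inr (List.mem_of_mem_head? hz))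
          simp only; omega
        · simpa using hd.2.2
      · intro v h1 h2
        have := h.count v h1 (by omega)
        have e1 : k + 1 ≠ v := by omega
        have e2 : M ≠ v := by omega
        simpa [List.count_cons, e1, e2] using this
      · intro s hs hi
        have hs' : s.Sublist ((flat p ++ [b]) ++ M :: flat q) := by simpa using hs
        obtain ⟨s₁, s₂, rfl, hs₁, hs₂⟩ := List.sublist_append_iff.1 hs'
        rcases List.sublist_cons_iff.1 hs₂ with hs₃ | ⟨s₂, rfl, hs₃⟩
        · refine h.avoid _ ?_ hi
          have := hs₁.append (hs₃.cons (k + 1))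
          simpa using this
        · rw [List.pairwise_append] at hi
          obtain rfl : s₂ = [] := by
            rw [List.eq_nil_iff_forall_not_mem]
            intro x hx
            have := (List.pairwise_cons.1 hi.2.1).1 x hx
            obtain ⟨y, hy, hyx⟩ := mem_flat.1 (hs₃.subset hx)
            have := hside y (.inr hy)
            omega
          have := h.avoid (s₁ ++ [k + 1]) ?_ ?_
          · simpa using this
          · have := hs₁.append ((List.nil_sublist (flat q)).cons_cons (k + 1))
            simpa using this
          · rw [List.pairwise_append]
            refine ⟨hi.1, by simp, fun x hx y hy => ?_⟩
            have hxM := hi.2.2 x hx M (by simp)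
            have hx' := hs₁.subset hx
            simp at hy
            rcases List.mem_append.1 hx' with hx' | hx'
            · obtain ⟨z, hz, hzx⟩ := mem_flat.1 hx'
              have := hside z (.inl hz)
              omega
            · simp at hx'
              omega
    refine ⟨hconf, .top p q b rfl rfl ?_⟩
    by_contra hcon
    push Not at hcon
    obtain ⟨hlt, u, hu, huM⟩ := hcon
    obtain ⟨l, r, h1, h2, h3⟩ := exists_isRun (M := M) (c := p ++ (b, M) :: q)
      fun x hx => (hconf.bot x hx).2.trans (by omega)
    rw [← h2] at hlt
    have hMq : [M].Sublist (flat q) := by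
      rw [List.singleton_sublist]; exact mem_flat.2 ⟨u, hu, .inr huM.symm⟩
    obtain ⟨a, rfl, rfl⟩ : ∃ a, p = l ++ a ∧ r = a ++ (b, M) :: q := by
      rw [List.append_eq_append_iff] at h1
      rcases h1 with ⟨a, rfl, hr⟩ | ⟨a, h⟩
      · obtain rfl : a = [] := by simpa using hlt
        exact ⟨[], by simp, by simpa using hr.symm⟩
      · exact ⟨a, h⟩
    match a, h3 with
    | [], h3 =>
      rcases h3.maximal (b, M) (by simp) with hs | ⟨z, hz, hzy⟩
      · exact hs rfl
      · have h5 : [z.1, b, k + 1, M].Sublist (flat (l ++ [] ++ (b, k + 1) :: q)) := by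
          have h6 : [z.1].Sublist (flat l) := by
            rw [List.singleton_sublist]; exact mem_flat.2 ⟨z, hz, .inl rfl⟩
          simpa using h6.append ((hMq.cons_cons (k + 1)).cons_cons b)
        have := h.avoid _ h5 (by simp at hzy ⊢; omega)
        simp at this
    | y :: a, h3 =>
      have hy := hside y (by simp)
      rcases h3.maximal y (by simp) with hs | ⟨z, hz, hzy⟩
      · have h5 : [y.1, y.2, k + 1, M].Sublist (flat (l ++ (y :: a) ++ (b, k + 1) :: q)) := by
          have h7 : [y.1, y.2].Sublist (flat (l ++ y :: a)) := by
            simp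
          simpa using h7.append ((hMq.cons_cons (k + 1)).cons b)
        have := h.avoid _ h5 (by simp; omega)
        simp at this
      · have h5 : [z.1, y.1, k + 1, M].Sublist (flat (l ++ (y :: a) ++ (b, k + 1) :: q)) := by
          have h6 : [z.1].Sublist (flat l) := by
            rw [List.singleton_sublist]; exact mem_flat.2 ⟨z, hz, .inl rfl⟩
          have h7 : [y.1].Sublist (flat (y :: a)) := by simp
          simpa using (h6.append h7).append ((hMq.cons_cons (k + 1)).cons b)
        have := h.avoid _ h5 (by simp; omega)
        simp at this

theorem Child.st_bot {M k : ℕ} (hk : k + 1 < M) {p q : List (ℕ × ℕ)} (h : Conf M k (p ++ q))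
    (hp : p.length ≤ run M M (p ++ q)) :
    st M (p ++ (k + 1, M) :: q) = ((st M (p ++ q)).1 + 1,
      if p.length = 0 then run M M (p ++ q) + 1 else p.length) := by
  have hb : ∀ x ∈ p ++ (k + 1, M) :: q, x.1 ≤ k + 1 := by
    intro x hx
    have := h.bot x
    grind
  have hpq := hb
  obtain ⟨l, r, rfl, h2, h3⟩ := h.exists_isRun_append (by omega) hp
  simp only [st, Prod.mk.injEq]
  constructor
  · simp [List.countP_append]; omega
  · rw [← h2]
    split_ifs with h0
    · obtain rfl : p = [] := List.length_eq_zero_iff.1 h0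
      have : IsRun M ((k + 1, M) :: l) r := by
        refine ⟨?_, ?_, ?_⟩
        · intro x hx
          rcases List.mem_cons.1 hx with rfl | hx
          · rfl
          · exact h3.top x hx
        · exact List.pairwise_cons.2 ⟨fun x hx => hb x (by simp [hx]), h3.dec⟩
        · intro x hx
          refine (h3.maximal x hx).imp_right ?_
          rintro ⟨y, hy, hyx⟩
          exact ⟨y, List.mem_cons_of_mem _ hy, hyx⟩
      have := this.run_eq fun x hx => (hb x (by simpa using hx)).trans hk.le
      simpa using this
    · have : IsRun M p ((k + 1, M) :: (l ++ r)) := by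
        refine ⟨fun x hx => h3.top x (by simp [hx]), (List.pairwise_append.1 h3.dec).1, ?_⟩
        intro x hx
        obtain ⟨y, hy⟩ := List.exists_mem_of_length_pos (Nat.pos_of_ne_zero h0)
        simp at hx
        subst hx
        exact .inr ⟨y, hy, Nat.lt_succ_of_le (h.bot y (by simp [hy])).2⟩
      exact this.run_eq fun x hx => (hb x hx).trans hk.le

theorem Child.st_top {M k b : ℕ} (hk : k + 1 < M) {p q : List (ℕ × ℕ)}
    (h : Conf M k (p ++ (b, M) :: q)) :
    (st M (p ++ (b, M) :: q)).1 = (st M (p ++ (b, k + 1) :: q)).1 + 1 ∧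
    (st M (p ++ (b, k + 1) :: q)).2 = min p.length (run M M (p ++ (b, M) :: q)) ∧
    (st M (p ++ (b, k + 1) :: q)).2 ≤ (st M (p ++ (b, k + 1) :: q)).1 := by
  have hb : ∀ x ∈ p ++ (b, k + 1) :: q, x.1 ≤ M := by
    intro x hx
    have := h.bot x
    have := h.bot (b, M) (by simp)
    grind
  have hkM : k + 1 ≠ M := by omega
  refine ⟨?_, ?_⟩
  · simp [st, List.countP_append, hkM]; omega
  simp only [st]
  suffices H : ∃ l r, p ++ (b, k + 1) :: q = l ++ r ∧ IsRun M l r ∧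
      l.length = min p.length (run M M (p ++ (b, M) :: q)) by
    obtain ⟨l, r, h1, h2, h3⟩ := H
    rw [h1] at hb ⊢
    rw [h2.run_eq hb]
    refine ⟨h3, ?_⟩
    rw [List.countP_append, List.countP_eq_length.2 fun x hx => by simpa using h2.top x hx]
    omega
  rcases le_or_gt (p.length + 1) (run M M (p ++ (b, M) :: q)) with hp | hp
  · have h' : Conf M k ((p ++ [(b, M)]) ++ q) := by simpa using h
    obtain ⟨l, r, rfl, -, hrun⟩ := h'.exists_isRun_append (by omega) (by simpa using hp)
    refine ⟨p, _, rfl, ⟨fun x hx => hrun.top x (by simp [hx]),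
      (List.pairwise_append.1 (List.pairwise_append.1 hrun.dec).1).1, ?_⟩, by omega⟩
    intro x hx
    simp at hx
    subst hx
    exact .inl hkM
  · obtain ⟨l, r, h1, h2, h3⟩ := exists_isRun (M := M) (c := p ++ (b, M) :: q)
      fun x hx => (h.bot x hx).2.trans (by omega)
    rw [← h2] at hp ⊢
    obtain ⟨a, rfl, rfl⟩ : ∃ a, p = l ++ a ∧ r = a ++ (b, M) :: q := by
      rw [List.append_eq_append_iff] at h1
      rcases h1 with ⟨a, rfl, hr⟩ | ⟨a, h⟩
      · obtain rfl : a = [] := by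
          simpa using hp
        exact ⟨[], by simp, by simpa using hr.symm⟩
      · exact ⟨a, h⟩
    refine ⟨l, a ++ (b, k + 1) :: q, by simp, ⟨h3.top, h3.dec, ?_⟩, by simp⟩
    intro x hx
    cases a with
    | nil =>
      simp at hx
      subst hx
      exact .inl hkM
    | cons y a => exact h3.maximal x (by simpa using hx)

theorem Child.move {M k : ℕ} (hk : k + 1 < M) {c c' : List (ℕ × ℕ)} (h : Conf M k c)
    (hc : Child M (k + 1) c c') : Move (st M c) (st M c') := by
  obtain ⟨p, q, rfl, rfl, hp⟩ | ⟨p, q, b, rfl, rfl, hp⟩ := hc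
  · left
    rw [Child.st_bot hk h hp]
    have e : (st M (p ++ q)).2 = run M M (p ++ q) := rfl
    refine ⟨rfl, ?_⟩
    simp only
    split_ifs <;> omega
  · right
    have := Child.st_top hk h
    have e : (st M (p ++ (b, M) :: q)).2 = run M M (p ++ (b, M) :: q) := rfl
    omega

theorem Child.eq_of_st_eq {M k : ℕ} (hk : k + 1 < M) {c c₁ c₂ : List (ℕ × ℕ)} (h : Conf M k c)
    (hc₁ : Child M (k + 1) c c₁) (hc₂ : Child M (k + 1) c c₂) (hst : st M c₁ = st M c₂) :
    c₁ = c₂ := by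
  have last : ∀ {p p' q q' : List (ℕ × ℕ)} {b b' : ℕ}, p ++ (b, M) :: q = p' ++ (b', M) :: q' →
      (∀ x ∈ q, x.2 ≠ M) → p'.length ≤ p.length := by
    intro p p' q q' b b' he hq
    rw [List.append_eq_append_iff] at he
    rcases he with ⟨a, rfl, he⟩ | ⟨a, rfl, he⟩
    · cases a with
      | nil => simp
      | cons y a =>
        simp only [List.cons_append, List.cons.injEq] at he
        exact absurd rfl (hq (b', M) (by simp [he.2]))
    · simp
  obtain ⟨p, q, hc, rfl, hp⟩ | ⟨p, q, b, hc, rfl, hp⟩ := hc₁ <;>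
  obtain ⟨p', q', hc', rfl, hp'⟩ | ⟨p', q', b', hc', rfl, hp'⟩ := hc₂
  · have e1 := Child.st_bot hk (hc ▸ h) (hc ▸ hp)
    have e2 := Child.st_bot hk (hc' ▸ h) (hc' ▸ hp')
    rw [← hc] at e1
    rw [← hc'] at e2
    rw [e1, e2, Prod.mk.injEq] at hst
    have hl : p.length = p'.length := by
      have := hst.2
      split_ifs at this <;> omega
    obtain ⟨rfl, rfl⟩ := List.append_inj (hc ▸ hc') hl
    rfl
  · have e1 := Child.st_bot hk (hc ▸ h) (hc ▸ hp)
    have e2 := Child.st_top hk (hc' ▸ h)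
    rw [← hc] at e1
    rw [← hc', ← hst, e1] at e2
    simp only at e2
    omega
  · have e1 := Child.st_bot hk (hc' ▸ h) (hc' ▸ hp')
    have e2 := Child.st_top hk (hc ▸ h)
    rw [← hc'] at e1
    rw [← hc, hst, e1] at e2
    simp only at e2
    omega
  · have e1 := (Child.st_top hk (hc ▸ h)).2.1
    have e2 := (Child.st_top hk (hc' ▸ h)).2.1
    rw [← hc] at e1
    rw [← hc'] at e2
    have hl : p.length = p'.length := by
      rw [← hst, e1] at e2
      rcases hp with hp | hp <;> rcases hp' with hp' | hp'
      · omega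
      · have := last (hc'.symm.trans hc) hp'
        omega
      · have := last (hc.symm.trans hc') hp
        omega
      · have := last (hc'.symm.trans hc) hp'
        have := last (hc.symm.trans hc') hp
        omega
    obtain ⟨rfl, h2⟩ := List.append_inj (hc.symm.trans hc') hl
    simp only [List.cons.injEq, Prod.mk.injEq, and_true] at h2
    rw [h2.1, h2.2]

theorem exists_child {M k : ℕ} (hk : k + 1 < M) {c : List (ℕ × ℕ)} (h : Conf M k c) {t : ℕ × ℕ}
    (ht : Move (st M c) t) : ∃ c', Child M (k + 1) c c' ∧ st M c' = t := by
  obtain ⟨l, r, rfl, h2, h3⟩ := exists_isRun (M := M) (c := c)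
    fun x hx => (h.bot x hx).2.trans (by omega)
  have e : (st M (l ++ r)).2 = run M M (l ++ r) := rfl
  have key : ∀ i, i ≤ l.length → ∃ p q, l = p ++ q ∧ p.length = i := fun i hi =>
    ⟨l.take i, l.drop i, by simp, by simpa using hi⟩
  obtain ⟨t1, t2⟩ := t
  rcases ht with ht | ht <;> simp only at ht
  · by_cases hlt : t2 ≤ l.length
    · obtain ⟨p, q, rfl, hp⟩ := key t2 hlt
      have hrun : p.length ≤ run M M (p ++ (q ++ r)) := by
        rw [← List.append_assoc, ← h2]; simp
      refine ⟨_, .bot p (q ++ r) (by simp) rfl (by simpa using hrun), ?_⟩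
      rw [List.append_assoc] at h
      rw [Child.st_bot hk h hrun, if_neg (by omega), ← List.append_assoc, ht.1, hp]
    · refine ⟨_, .bot [] (l ++ r) rfl rfl (by simp), ?_⟩
      rw [Child.st_bot (p := []) (q := l ++ r) hk h (by simp)]
      simp only [List.length_nil, if_true, List.nil_append, Prod.mk.injEq]
      omega
  · by_cases hlt : t2 < l.length
    · obtain ⟨p, q, rfl, hp⟩ := key t2 hlt.le
      match q, hlt, h2, h3, h, ht, e with
      | [], hlt, _, _, _, _, _ => simp at hlt; omega
      | (b, m) :: q, hlt, h2, h3, h, ht, e =>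
        obtain rfl : m = M := h3.top (b, m) (by simp)
        simp only [List.append_assoc, List.cons_append] at h h2 ht e ⊢
        have hl : p.length < run m m (p ++ (b, m) :: (q ++ r)) := by
          rw [← h2]; simp
        refine ⟨_, .top p (q ++ r) b rfl rfl (.inl hl), ?_⟩
        have := Child.st_top hk h
        ext <;> simp only <;> omega
    · have hM : ∃ x ∈ r, x.2 = M := by
        by_contra hcon
        push Not at hcon
        have : (st M (l ++ r)).1 ≤ l.length := by
          have h0 : r.countP (fun x => decide (x.2 = M)) = 0 := by
            rw [List.countP_eq_zero]; simpa using hcon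
          simp only [st, List.countP_append, h0]
          exact List.countP_le_length
        omega
      obtain ⟨u, b, v, rfl, hv⟩ : ∃ u b v, r = u ++ (b, M) :: v ∧ ∀ x ∈ v, x.2 ≠ M := by
        clear h h2 h3 ht e hlt key
        induction r using List.reverseRecOn with
        | nil => simp at hM
        | append_singleton r x ih =>
          by_cases hx : x.2 = M
          · exact ⟨r, x.1, [], by simp [← hx], by simp⟩
          · obtain ⟨u, b, v, rfl, hv⟩ := ih (by
              obtain ⟨y, hy, hyM⟩ := hM
              simp at hy
              rcases hy with hy | rfl
              · exact ⟨y, hy, hyM⟩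
              · exact absurd hyM hx)
            refine ⟨u, b, v ++ [x], by simp, ?_⟩
            intro y hy
            simp at hy
            rcases hy with hy | rfl
            · exact hv y hy
            · exact hx
      rw [← List.append_assoc] at h h2 ht e ⊢
      refine ⟨_, .top (l ++ u) v b rfl rfl (.inr hv), ?_⟩
      have := Child.st_top hk h
      rw [← h2] at this
      simp only [List.length_append] at this
      ext <;> simp only <;> omega

theorem Conf.restrict_self {M k : ℕ} {c : List (ℕ × ℕ)} (h : Conf M k c) : restrict M k c = c :=
  restrict_eq_self fun x hx => ⟨(h.bot x hx).2, (h.top x hx).2⟩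

theorem Conf.eq_nil {M : ℕ} {c : List (ℕ × ℕ)} (h : Conf M 0 c) : c = [] := by
  rw [List.eq_nil_iff_forall_not_mem]
  intro x hx
  have := h.bot x hx
  omega

theorem conf_nil (M : ℕ) : Conf M 0 [] :=
  ⟨by simp, by simp, by simp, fun v h1 h2 => by omega, fun s hs _ => by simp_all⟩

theorem Conf.restrict_of_le {M j k : ℕ} (hk : k < M) {c : List (ℕ × ℕ)} (h : Conf M k c)
    (hj : j ≤ k) : Conf M j (restrict M j c) := by
  induction k generalizing c with
  | zero =>
    obtain rfl : j = 0 := by omega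
    rwa [h.restrict_self]
  | succ k ih =>
    rcases hj.lt_or_eq with hj | rfl
    · rw [← restrict_restrict (k := k) (by omega) (by omega)]
      exact ih (by omega) (h.restrict_child hk).1 (by omega)
    · rwa [h.restrict_self]

/-- The sequence of states of the restrictions of `c`. -/
def trace (M : ℕ) (c : List (ℕ × ℕ)) (i : ℕ) : ℕ × ℕ := st M (restrict M i c)

theorem trace_restrict {M i k : ℕ} (hik : i ≤ k) (hM : i < M) (c : List (ℕ × ℕ)) :
    trace M (restrict M k c) i = trace M c i := by
  rw [trace, restrict_restrict hik hM, trace]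

theorem Conf.trace_zero {M k : ℕ} (hk : k < M) {c : List (ℕ × ℕ)} (h : Conf M k c) :
    trace M c 0 = (0, 0) := by
  rw [trace, (h.restrict_of_le hk (Nat.zero_le _)).eq_nil]
  rfl

theorem Conf.trace_move {M i k : ℕ} (hk : k < M) {c : List (ℕ × ℕ)} (h : Conf M k c)
    (hi : i < k) : Move (trace M c i) (trace M c (i + 1)) := by
  have h1 := (h.restrict_of_le hk (show i + 1 ≤ k from hi)).restrict_child (by omega)
  rw [restrict_restrict (by omega) (by omega)] at h1
  exact h1.2.move (by omega) h1.1

theorem exists_conf_of_moves {M k : ℕ} (hk : k < M) {s : ℕ → ℕ × ℕ} (h0 : s 0 = (0, 0))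
    (hs : ∀ i < k, Move (s i) (s (i + 1))) : ∃ c, Conf M k c ∧ ∀ i ≤ k, trace M c i = s i := by
  induction k with
  | zero =>
    refine ⟨[], conf_nil M, fun i hi => ?_⟩
    obtain rfl : i = 0 := by omega
    rw [h0, (conf_nil M).trace_zero hk]
  | succ k ih =>
    obtain ⟨c, hc, hci⟩ := ih (by omega) fun i hi => hs i (by omega)
    have hck : st M c = s k := by
      rw [← hci k le_rfl, trace, hc.restrict_self]
    obtain ⟨c', hc', ht⟩ := exists_child hk hc (t := s (k + 1)) (hck ▸ hs k (by omega))
    have hconf := hc'.conf hk hc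
    refine ⟨c', hconf, fun i hi => ?_⟩
    rcases hi.lt_or_eq with hi | rfl
    · rw [← trace_restrict (k := k) (by omega) (by omega), hc'.restrict_eq hc, hci i (by omega)]
    · rw [trace, hconf.restrict_self, ht]

theorem Conf.eq_of_trace_eq {M k : ℕ} (hk : k < M) {c d : List (ℕ × ℕ)} (hc : Conf M k c)
    (hd : Conf M k d) (h : ∀ i ≤ k, trace M c i = trace M d i) : c = d := by
  induction k generalizing c d with
  | zero => rw [hc.eq_nil, hd.eq_nil]
  | succ k ih =>
    have h1 := hc.restrict_child hk
    have h2 := hd.restrict_child hk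
    have e : restrict M k c = restrict M k d := by
      refine ih (by omega) h1.1 h2.1 fun i hi => ?_
      rw [trace_restrict hi (by omega), trace_restrict hi (by omega), h i (by omega)]
    have e2 := h (k + 1) le_rfl
    rw [trace, trace, hc.restrict_self, hd.restrict_self] at e2
    exact Child.eq_of_st_eq hk h1.1 h1.2 (e ▸ h2.2) e2

/-- Sequences of states with `N` moves from `(0, 0)` to `(0, 0)`, constant afterwards. -/
structure IsWalk (N : ℕ) (s : ℕ → ℕ × ℕ) : Prop where
  zero : s 0 = (0, 0)
  move : ∀ i < N, Move (s i) (s (i + 1))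
  eq_zero : ∀ i, N ≤ i → s i = (0, 0)

theorem Conf.trace_of_le {M k i : ℕ} {c : List (ℕ × ℕ)} (h : Conf M k c)
    (hi : k ≤ i) : trace M c i = st M c := by
  rw [trace, restrict_eq_self]
  intro x hx
  have h1 := h.bot x hx
  have h2 := h.top x hx
  omega

/-- Complete configurations correspond to walks. -/
noncomputable def confEquivWalk {M N : ℕ} (hN : N < M) :
    {c // Conf M N c ∧ st M c = (0, 0)} ≃ {s // IsWalk N s} :=
  Equiv.ofBijective
    (fun c => ⟨trace M c.1, c.2.1.trace_zero hN, fun _ hi => c.2.1.trace_move hN hi,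
      fun _ hi => (c.2.1.trace_of_le hi).trans c.2.2⟩) <| by
    constructor
    · intro c d h
      rw [Subtype.mk.injEq] at h
      exact Subtype.ext (c.2.1.eq_of_trace_eq hN d.2.1 fun i _ => congrFun h i)
    · rintro ⟨s, h0, h1, h2⟩
      obtain ⟨c, hc, ht⟩ := exists_conf_of_moves hN h0 h1
      have hst : st M c = (0, 0) := by
        rw [← hc.trace_of_le le_rfl, ht N le_rfl, h2 N le_rfl]
      refine ⟨⟨c, hc, hst⟩, Subtype.ext (funext fun i => ?_)⟩
      rcases le_total i N with hi | hi
      · exact ht i hi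
      · exact ((hc.trace_of_le hi).trans hst).trans (h2 i hi).symm

theorem flat_injective : Function.Injective flat := by
  intro c
  induction c with
  | nil =>
    intro d h
    cases d with
    | nil => rfl
    | cons y d => simp at h
  | cons x c ih =>
    intro d h
    cases d with
    | nil => simp at h
    | cons y d =>
      simp only [flat_cons, List.cons.injEq] at h
      rw [ih h.2.2, Prod.ext h.1 h.2.1]

theorem length_flat (c : List (ℕ × ℕ)) : (flat c).length = 2 * c.length := by
  induction c with
  | nil => rfl
  | cons x c ih => simp [ih]; omega

theorem exists_flat_eq {n : ℕ} {w : List ℕ} (h : w.length = 2 * n) : ∃ c, flat c = w := by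
  induction n generalizing w with
  | zero => exact ⟨[], (List.length_eq_zero_iff.1 h).symm⟩
  | succ n ih =>
    match w, h with
    | a :: b :: w, h =>
      obtain ⟨c, rfl⟩ := ih (w := w) (by simp at h; omega)
      exact ⟨(a, b) :: c, rfl⟩

theorem letter_flat {l : List (ℕ × ℕ)} {i : ℕ} (hi : i < l.length) :
    letter (flat l) (2 * i + 1) = l[i].1 ∧ letter (flat l) (2 * (i + 1)) = l[i].2 := by
  induction l generalizing i with
  | nil => simp at hi
  | cons x l ih =>
    cases i with
    | zero => simp [letter]
    | succ i =>
      have := ih (i := i) (by simpa using hi)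
      simpa [letter, Nat.mul_add] using this

theorem isUpDown_flat {n : ℕ} {l : List (ℕ × ℕ)} (hc : l.length = n) :
    IsUpDown n (flat l) ↔ (∀ x ∈ l, x.1 < x.2) ∧ l.IsChain fun x y => y.1 < x.2 := by
  rw [IsUpDown, List.isChain_iff_getElem, List.forall_mem_iff_getElem]
  refine and_congr ⟨fun h i hi => ?_, fun h i h1 h2 => ?_⟩ ⟨fun h i hi => ?_, fun h i h1 h2 => ?_⟩
  · have := h (i + 1) (by omega) (by omega)
    rwa [(letter_flat hi).2, show 2 * (i + 1) - 1 = 2 * i + 1 by omega, (letter_flat hi).1] at this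
  · obtain ⟨i, rfl⟩ := Nat.exists_eq_succ_of_ne_zero (show i ≠ 0 by omega)
    have hi : i < l.length := by omega
    have := h i hi
    rwa [Nat.succ_eq_add_one, (letter_flat hi).2, show 2 * (i + 1) - 1 = 2 * i + 1 by omega,
      (letter_flat hi).1]
  · have := h (i + 1) (by omega) (by omega)
    rwa [(letter_flat (show i < l.length by omega)).2, (letter_flat hi).1] at this
  · obtain ⟨i, rfl⟩ := Nat.exists_eq_succ_of_ne_zero (show i ≠ 0 by omega)
    have hi : i + 1 < l.length := by omega
    have := h i hi
    rwa [Nat.succ_eq_add_one, (letter_flat (show i < l.length by omega)).2, (letter_flat hi).1]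

theorem avoids1234_iff_noInc4 {w : List ℕ} : Avoids1234 w ↔ NoInc4 w := by
  have hl : ∀ i (hi : i < w.length), letter w (i + 1) = w[i] := by
    intro i hi
    simp [letter, hi]
  constructor
  · intro h s hs hi
    by_contra hlen
    match s, hs, hi, hlen with
    | [], _, _, hlen => simp at hlen
    | [_], _, _, hlen => simp at hlen
    | [_, _], _, _, hlen => simp at hlen
    | [_, _, _], _, _, hlen => simp at hlen
    | a :: b :: c :: d :: s, hs, hi, _ =>
      have hs' : [a, b, c, d].Sublist w := List.Sublist.trans (by simp) hs
      obtain ⟨is, h1, h2⟩ := List.sublist_eq_map_getElem hs'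
      match is, h1, h2 with
      | [p, q, r, t], h1, h2 =>
        simp only [List.map_cons, List.map_nil, List.cons.injEq, and_true] at h1
        obtain ⟨rfl, rfl, rfl, rfl⟩ := h1
        simp only [List.pairwise_cons, List.mem_cons, forall_eq_or_imp] at hi h2
        refine h ⟨p + 1, q + 1, r + 1, t + 1, by omega, ?_, ?_, ?_, by omega, ?_⟩
        · have := h2.1.1; omega
        · have := h2.2.1.1; omega
        · have := h2.2.2.1.1; omega
        · rw [hl p p.2, hl q q.2, hl r r.2, hl t t.2]
          exact ⟨hi.1.1, hi.2.1.1, hi.2.2.1.1⟩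
  · rintro h ⟨p, q, r, t, h1, h2, h3, h4, h5, h6⟩
    obtain ⟨p, rfl⟩ := Nat.exists_eq_succ_of_ne_zero (show p ≠ 0 by omega)
    obtain ⟨q, rfl⟩ := Nat.exists_eq_succ_of_ne_zero (show q ≠ 0 by omega)
    obtain ⟨r, rfl⟩ := Nat.exists_eq_succ_of_ne_zero (show r ≠ 0 by omega)
    obtain ⟨t, rfl⟩ := Nat.exists_eq_succ_of_ne_zero (show t ≠ 0 by omega)
    simp only [Nat.succ_eq_add_one] at *
    rw [hl p (by omega), hl q (by omega), hl r (by omega), hl t (by omega)] at h6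
    have := h _ (List.map_getElem_sublist (l := w)
      (is := [⟨p, by omega⟩, ⟨q, by omega⟩, ⟨r, by omega⟩, ⟨t, by omega⟩]) (by simp; omega))
      (by simp; omega)
    simp at this

theorem isPermWord_iff_count {N : ℕ} {w : List ℕ} : IsPermWord N w ↔
    (∀ v ∈ w, 1 ≤ v ∧ v ≤ N) ∧ ∀ v, 1 ≤ v → v ≤ N → w.count v = 1 := by
  constructor
  · rintro ⟨h1, h2⟩
    have hfin : w.toFinset = Finset.Icc 1 N := by
      ext v; simpa using h2 v
    have hnd : w.Nodup := by
      rw [← Multiset.coe_nodup, ← Multiset.toFinset_card_eq_card_iff_nodup]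
      simp [hfin, h1]
    refine ⟨fun v hv => by simpa using (h2 v).1 hv, fun v hv1 hv2 => ?_⟩
    exact List.count_eq_one_of_mem hnd ((h2 v).2 (by simp [hv1, hv2]))
  · rintro ⟨h1, h2⟩
    have hmem : ∀ v, v ∈ w ↔ v ∈ Finset.Icc 1 N := by
      intro v
      rw [Finset.mem_Icc]
      refine ⟨h1 v, fun hv => ?_⟩
      rw [← List.count_pos_iff, h2 v hv.1 hv.2]
      exact Nat.one_pos
    have hnd : w.Nodup := by
      rw [List.nodup_iff_count_le_one]
      intro v
      by_cases hv : v ∈ w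
      · rw [h2 v (h1 v hv).1 (h1 v hv).2]
      · rw [List.count_eq_zero_of_not_mem hv]; omega
    refine ⟨?_, hmem⟩
    rw [← List.toFinset_card_of_nodup hnd, show w.toFinset = Finset.Icc 1 N by ext v; simpa using hmem v]
    simp

theorem run_le_countP (M m : ℕ) (c : List (ℕ × ℕ)) :
    run M m c ≤ c.countP fun x => decide (x.2 = M) := by
  obtain ⟨l, r, rfl, h2, h3, -⟩ := exists_run M m c
  rw [← h2, List.countP_append, List.countP_eq_length.2 fun x hx => by simpa using (h3 x hx).1]
  omega

theorem st_eq_zero_iff {M : ℕ} {c : List (ℕ × ℕ)} : st M c = (0, 0) ↔ ∀ x ∈ c, x.2 ≠ M := by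
  have h := run_le_countP M M c
  have : (∀ x ∈ c, x.2 ≠ M) ↔ c.countP (fun x => decide (x.2 = M)) = 0 := by
    rw [List.countP_eq_zero]; simp
  rw [this, st, Prod.mk.injEq]
  omega

theorem isA_flat_iff {n : ℕ} {c : List (ℕ × ℕ)} :
    IsA n (flat c) ↔ Conf (2 * n + 1) (2 * n) c ∧ st (2 * n + 1) c = (0, 0) := by
  rw [IsA, avoids1234_iff_noInc4, st_eq_zero_iff]
  constructor
  · rintro ⟨hp, hu, ha⟩
    have hlen : c.length = n := by
      have := hp.1
      rw [length_flat] at this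
      omega
    rw [isUpDown_flat hlen] at hu
    rw [isPermWord_iff_count] at hp
    have hb : ∀ x ∈ c, (1 ≤ x.1 ∧ x.1 ≤ 2 * n) ∧ x.2 ≤ 2 * n := fun x hx =>
      ⟨hp.1 _ (mem_flat.2 ⟨x, hx, .inl rfl⟩), (hp.1 _ (mem_flat.2 ⟨x, hx, .inr rfl⟩)).2⟩
    refine ⟨⟨fun x hx => (hb x hx).1, fun x hx => ⟨hu.1 x hx, .inl (hb x hx).2⟩, hu.2, hp.2, ha⟩, ?_⟩
    intro x hx
    have := hb x hx
    omega
  · rintro ⟨h, h0⟩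
    have hp : IsPermWord (2 * n) (flat c) := by
      rw [isPermWord_iff_count]
      refine ⟨fun v hv => ?_, h.count⟩
      obtain ⟨x, hx, hv⟩ := mem_flat.1 hv
      have h1 := h.bot x hx
      have h2 := h.top x hx
      have h3 := h0 x hx
      omega
    have hlen : c.length = n := by
      have := hp.1
      rw [length_flat] at this
      omega
    exact ⟨hp, (isUpDown_flat hlen).2 ⟨fun x hx => (h.top x hx).1, h.down⟩, h.avoid⟩

/-- Complete configurations are the pairings of up-down words. -/
noncomputable def confEquivA (n : ℕ) :
    {c // Conf (2 * n + 1) (2 * n) c ∧ st (2 * n + 1) c = (0, 0)} ≃ {w // IsA n w} :=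
  Equiv.ofBijective (fun c => ⟨flat c.1, isA_flat_iff.2 c.2⟩) <| by
    constructor
    · intro c d h
      rw [Subtype.mk.injEq] at h
      exact Subtype.ext (flat_injective h)
    · rintro ⟨w, hw⟩
      obtain ⟨c, rfl⟩ := exists_flat_eq hw.1.1
      exact ⟨⟨c, isA_flat_iff.1 hw⟩, rfl⟩

theorem take_succ_getD {s : List Bool} {i : ℕ} (hi : i < s.length) :
    s.take (i + 1) = s.take i ++ [s.getD i false] := by
  rw [List.take_add_one, List.getD_eq_getElem _ _ hi, List.getElem?_eq_getElem hi]
  rfl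

theorem ht_zero (s : List Bool) : ht s 0 = 0 := by simp [ht]

theorem ht_succ_of_true {s : List Bool} (hd : IsDyck s) {i : ℕ} (hi : i < s.length)
    (h : s.getD i false = true) : ht s (i + 1) = ht s i + 1 := by
  have := hd.1 i
  simp only [ht, take_succ_getD hi, h, List.count_append, List.count_singleton]
  simp
  omega

theorem ht_of_false {s : List Bool} (hd : IsDyck s) {i : ℕ} (hi : i < s.length)
    (h : s.getD i false = false) : ht s i = ht s (i + 1) + 1 := by
  have h1 := hd.1 i
  have h2 := hd.1 (i + 1)
  simp only [ht, take_succ_getD hi, h, List.count_append, List.count_singleton] at h2 ⊢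
  simp at h2 ⊢
  omega

theorem ht_of_length_le {s : List Bool} (hd : IsDyck s) {i : ℕ} (hi : s.length ≤ i) :
    ht s i = 0 := by
  rw [ht, List.take_of_length_le hi, hd.2, Nat.sub_self]

/-- The state of a weighted path after `i` steps: the height, and the last weight, complemented
with respect to the height when the last step is an up-step. -/
def pathState (p : WDP) : ℕ → ℕ × ℕ
  | 0 => (0, 0)
  | i + 1 => (ht p.steps (i + 1), if p.steps.getD i false = true then
      ht p.steps (i + 1) - p.weights.getD i 0 else p.weights.getD i 0)

theorem pathState_fst (p : WDP) (i : ℕ) : (pathState p i).1 = ht p.steps i := by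
  cases i with
  | zero => rw [ht_zero]; rfl
  | succ i => rfl

theorem IsWD.isWalk {n : ℕ} {p : WDP} (hp : IsWD n p) : IsWalk (2 * n) (pathState p) := by
  obtain ⟨hs, hw, hd, h1, h2, h3, h4, h5⟩ := hp
  refine ⟨rfl, fun i hi => ?_, fun i hi => ?_⟩
  · have hb := h1 i hi
    cases i with
    | zero =>
      have h0 := ht_zero p.steps
      cases e : p.steps.getD 0 false with
      | true =>
        have := ht_succ_of_true hd (by omega) e
        simp only [Move, pathState, e, if_true]
        omega
      | false =>
        have := ht_of_false hd (by omega) e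
        omega
    | succ i =>
      have hb' := h1 i (by omega)
      have h2 := h2 i hi
      have h3 := h3 i hi
      have h4 := h4 i hi
      have h5 := h5 i hi
      simp only [Move, pathState]
      cases e : p.steps.getD i false <;> cases e' : p.steps.getD (i + 1) false <;>
        simp only [e, e', forall_const, reduceCtorEq, false_imp_iff, if_true, if_false,
          Bool.false_eq_true] at h2 h3 h4 h5 ⊢
      · have := ht_of_false hd (by omega) e
        have := ht_of_false hd (by omega) e'
        omega
      · have := ht_of_false hd (by omega) e
        have := ht_succ_of_true hd (by omega) e'
        omega
      · have := ht_succ_of_true hd (by omega) e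
        have := ht_of_false hd (by omega) e'
        omega
      · have := ht_succ_of_true hd (by omega) e
        have := ht_succ_of_true hd (by omega) e'
        omega
  · cases i with
    | zero => rfl
    | succ i =>
      have hh : ht p.steps (i + 1) = 0 := ht_of_length_le hd (by omega)
      have hwt : p.weights.getD i 0 = 0 := by
        rcases hi.lt_or_eq with hi | hi
        · exact List.getD_eq_default _ _ (by omega)
        · have := h1 i (by omega)
          omega
      simp only [pathState, hh, hwt]
      simp

theorem pathState_injOn {n : ℕ} {p q : WDP} (hp : IsWD n p) (hq : IsWD n q)
    (h : pathState p = pathState q) : p = q := by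
  obtain ⟨hs, hw, hd, h1, -⟩ := hp
  obtain ⟨hs', hw', hd', h1', -⟩ := hq
  have hht : ∀ i, ht p.steps i = ht q.steps i := fun i => by
    rw [← pathState_fst, h, pathState_fst]
  have hst : ∀ i < 2 * n, p.steps.getD i false = q.steps.getD i false := by
    intro i hi
    have e1 := hht i
    have e2 := hht (i + 1)
    cases e : p.steps.getD i false <;> cases e' : q.steps.getD i false
    · rfl
    · have := ht_of_false hd (by omega) e
      have := ht_succ_of_true hd' (by omega) e'
      omega
    · have := ht_succ_of_true hd (by omega) e
      have := ht_of_false hd' (by omega) e'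
      omega
    · rfl
  have hwt : ∀ i < 2 * n, p.weights.getD i 0 = q.weights.getD i 0 := by
    intro i hi
    have e := congrArg Prod.snd (congrFun h (i + 1))
    simp only [pathState, hst i hi, hht] at e
    have := h1 i hi
    have := h1' i hi
    have := hht (i + 1)
    split_ifs at e <;> omega
  have hsteps : p.steps = q.steps := by
    refine List.ext_getElem (by omega) fun i hi hi' => ?_
    have := hst i (by omega)
    rwa [List.getD_eq_getElem _ _ hi, List.getD_eq_getElem _ _ hi'] at this
  have hweights : p.weights = q.weights := by
    refine List.ext_getElem (by omega) fun i hi hi' => ?_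
    have := hwt i (by omega)
    rwa [List.getD_eq_getElem _ _ hi, List.getD_eq_getElem _ _ hi'] at this
  cases p; cases q
  simp_all

/-- The weighted path with a given sequence of states. -/
def pathOfWalk (N : ℕ) (s : ℕ → ℕ × ℕ) : WDP where
  steps := (List.range N).map fun i => decide ((s i).1 < (s (i + 1)).1)
  weights := (List.range N).map fun i =>
    if (s i).1 < (s (i + 1)).1 then (s (i + 1)).1 - (s (i + 1)).2 else (s (i + 1)).2

theorem getD_map_range {α : Type*} {N i : ℕ} (hi : i < N) (f : ℕ → α) (d : α) :
    ((List.range N).map f).getD i d = f i := by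
  simp [List.getD, hi]

theorem IsWalk.snd_le {N : ℕ} {s : ℕ → ℕ × ℕ} (h : IsWalk N s) {i : ℕ} (hi : i ≤ N) :
    (s i).2 ≤ (s i).1 := by
  induction i with
  | zero => rw [h.zero]
  | succ i ih =>
    have := ih (by omega)
    rcases h.move i hi with h | h <;> omega

theorem IsWalk.count_steps {N : ℕ} {s : ℕ → ℕ × ℕ} (h : IsWalk N s) {i : ℕ} (hi : i ≤ N) :
    ((pathOfWalk N s).steps.take i).count true =
      ((pathOfWalk N s).steps.take i).count false + (s i).1 := by
  induction i with
  | zero => simp [h.zero]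
  | succ i ih =>
    have ih := ih (by omega)
    have e : (pathOfWalk N s).steps.getD i false = decide ((s i).1 < (s (i + 1)).1) :=
      getD_map_range hi _ _
    rw [take_succ_getD (by simpa [pathOfWalk] using hi), List.count_append, List.count_append,
      List.count_singleton, List.count_singleton, e]
    rcases h.move i hi with hm | hm
    · have : (s i).1 < (s (i + 1)).1 := by omega
      simp [this]; omega
    · have : ¬ (s i).1 < (s (i + 1)).1 := by omega
      simp [this]; omega

theorem IsWalk.ht_pathOfWalk {N : ℕ} {s : ℕ → ℕ × ℕ} (h : IsWalk N s) {i : ℕ} (hi : i ≤ N) :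
    ht (pathOfWalk N s).steps i = (s i).1 := by
  rw [ht, h.count_steps hi]; omega

theorem IsWalk.isDyck {N : ℕ} {s : ℕ → ℕ × ℕ} (h : IsWalk N s) :
    IsDyck (pathOfWalk N s).steps := by
  have hlen : (pathOfWalk N s).steps.length = N := by simp [pathOfWalk]
  have hN := h.count_steps le_rfl
  rw [List.take_of_length_le (by omega), h.eq_zero N le_rfl] at hN
  refine ⟨fun k => ?_, by omega⟩
  rcases le_total k N with hk | hk
  · have := h.count_steps hk
    omega
  · rw [List.take_of_length_le (by omega)]
    omega

theorem IsWalk.isWD {n : ℕ} {s : ℕ → ℕ × ℕ} (h : IsWalk (2 * n) s) :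
    IsWD n (pathOfWalk (2 * n) s) := by
  have hst : ∀ i < 2 * n, (pathOfWalk (2 * n) s).steps.getD i false =
      decide ((s i).1 < (s (i + 1)).1) := fun i hi => getD_map_range hi _ _
  have hwt : ∀ i < 2 * n, (pathOfWalk (2 * n) s).weights.getD i 0 =
      if (s i).1 < (s (i + 1)).1 then (s (i + 1)).1 - (s (i + 1)).2 else (s (i + 1)).2 :=
    fun i hi => getD_map_range hi _ _
  refine ⟨by simp [pathOfWalk], by simp [pathOfWalk], h.isDyck, ?_, ?_, ?_, ?_, ?_⟩
  · intro i hi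
    rw [hwt i hi, h.ht_pathOfWalk hi.le, h.ht_pathOfWalk (i := i + 1) hi]
    have := h.snd_le (i := i + 1) hi
    rcases h.move i hi with hm | hm <;> split_ifs <;> omega
  all_goals
    intro i hi
    rw [hst i (by omega), hst (i + 1) hi, hwt i (by omega), hwt (i + 1) hi]
    try rw [h.ht_pathOfWalk (by omega)]
    have h1 := h.snd_le (i := i + 1) (by omega)
    have h2 := h.snd_le (i := i + 1 + 1) hi
    have h3 := h.move i (by omega)
    have h4 := h.move (i + 1) hi
    simp only [decide_eq_true_eq, decide_eq_false_iff_not]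
    unfold Move at h3 h4
    intro e e'
    simp only [e, e', if_true, if_false]
    omega

theorem IsWalk.pathState_pathOfWalk {n : ℕ} {s : ℕ → ℕ × ℕ} (h : IsWalk (2 * n) s) :
    pathState (pathOfWalk (2 * n) s) = s := by
  funext i
  rcases le_or_gt i (2 * n) with hi | hi
  · cases i with
    | zero => exact h.zero.symm
    | succ i =>
      have hst : (pathOfWalk (2 * n) s).steps.getD i false =
        decide ((s i).1 < (s (i + 1)).1) := getD_map_range hi _ _
      have hwt : (pathOfWalk (2 * n) s).weights.getD i 0 =
        if (s i).1 < (s (i + 1)).1 then (s (i + 1)).1 - (s (i + 1)).2 else (s (i + 1)).2 :=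
        getD_map_range hi _ _
      have h1 := h.snd_le hi
      rw [pathState, hst, hwt, h.ht_pathOfWalk hi]
      ext
      · rfl
      · simp only [decide_eq_true_eq]
        split_ifs <;> omega
  · rw [h.isWD.isWalk.eq_zero i hi.le, h.eq_zero i hi.le]

/-- Weighted Dyck paths correspond to walks. -/
noncomputable def wdEquivWalk (n : ℕ) : {p : WDP // IsWD n p} ≃ {s // IsWalk (2 * n) s} where
  toFun p := ⟨pathState p.1, p.2.isWalk⟩
  invFun s := ⟨pathOfWalk (2 * n) s.1, s.2.isWD⟩
  left_inv p := Subtype.ext <|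
    pathState_injOn p.2.isWalk.isWD p.2 p.2.isWalk.pathState_pathOfWalk
  right_inv s := Subtype.ext s.2.pathState_pathOfWalk

/-- `WD_{2n}` and `A_{2n}(1234)` have the same cardinality. -/
theorem WD_equiv_A (n : ℕ) (hn : 1 ≤ n) :
    Nonempty ({p : WDP // IsWD n p} ≃ {w : List ℕ // IsA n w}) := by
  exact ⟨(wdEquivWalk n).trans ((confEquivWalk (Nat.lt_succ_self _)).symm.trans (confEquivA n))⟩
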